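/- arXiv:2605.14302 — 2 statements merged into one kernel-verified Lean document; each statement's English description precedes it below -/
import Mathlib

section
/- Let a, b ≥ 0 with a + b > 0, and let c > 0 satisfy 2c(a+b) ≤ a² + b². Then the infimum of the set { M ≥ 0 : there exists G : ℝ → ℝ differentiable on [0,1] with G(0) = 0, G(1) = c, G'(0) = a, G'(1) = b, G'(t) ≥ 0 for all t ∈ [0,1], and G' Lipschitz on [0,1] with constant M } equals (a² + b²)/(2c); moreover this infimum is attained. -/
open Set

/-- A function with nonnegative one-sided derivative on `[0, 1]` is monotone there. -/
lemma monotoneOn_unitInterval_of_hasDerivWithinAt_nonneg {F f : ℝ → ℝ}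
    (hF : ∀ t ∈ Icc (0 : ℝ) 1, HasDerivWithinAt F (f t) (Icc (0 : ℝ) 1) t)
    (hf : ∀ t ∈ Icc (0 : ℝ) 1, 0 ≤ f t) : MonotoneOn F (Icc (0 : ℝ) 1) :=
  monotoneOn_of_hasDerivWithinAt_nonneg (convex_Icc 0 1)
    (fun t ht => (hF t ht).continuousWithinAt)
    (fun t ht => (hF t (interior_subset ht)).mono interior_subset)
    (fun t ht => hf t (interior_subset ht))

/-- If `G' = g ≥ 0` is `M`-Lipschitz on `[0, 1]`, the increment of `G` dominates the areas of the
truncated triangles of slope `M` at both ends. -/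
lemma increment_ge_of_lipschitz_deriv {G g : ℝ → ℝ} {M p q : ℝ}
    (hG : ∀ t ∈ Icc (0 : ℝ) 1, HasDerivWithinAt G (g t) (Icc (0 : ℝ) 1) t)
    (hg : ∀ t ∈ Icc (0 : ℝ) 1, 0 ≤ g t)
    (hL : ∀ s ∈ Icc (0 : ℝ) 1, ∀ t ∈ Icc (0 : ℝ) 1, |g s - g t| ≤ M * |s - t|)
    (hp : 0 ≤ p) (hpq : p ≤ q) (hq : q ≤ 1) :
    g 0 * p - M * p ^ 2 / 2 + (g 1 * (1 - q) - M * (1 - q) ^ 2 / 2) ≤ G 1 - G 0 := by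
  have h0 : (0 : ℝ) ∈ Icc (0 : ℝ) 1 := by simp
  have h1 : (1 : ℝ) ∈ Icc (0 : ℝ) 1 := by simp
  have hpI : p ∈ Icc (0 : ℝ) 1 := ⟨hp, hpq.trans hq⟩
  have hqI : q ∈ Icc (0 : ℝ) 1 := ⟨hp.trans hpq, hq⟩
  have hleft : MonotoneOn (fun t => G t - g 0 * t + M * t ^ 2 / 2) (Icc (0 : ℝ) 1) := by
    refine monotoneOn_unitInterval_of_hasDerivWithinAt_nonneg
      (f := fun t => g t - g 0 + M * t) (fun t ht => ?_) (fun t ht => ?_)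
    · have hlin := ((hasDerivAt_id t).const_mul (g 0)).hasDerivWithinAt (s := Icc (0 : ℝ) 1)
      have hquad := (((hasDerivAt_pow 2 t).const_mul M).div_const 2).hasDerivWithinAt
        (s := Icc (0 : ℝ) 1)
      exact (((hG t ht).sub hlin).add hquad).congr_deriv (by norm_num; ring)
    · have h := (abs_le.1 (hL t ht 0 h0)).1
      rw [sub_zero, abs_of_nonneg ht.1] at h
      linarith
  have hright : MonotoneOn (fun t => G t - g 1 * t - M * (1 - t) ^ 2 / 2) (Icc (0 : ℝ) 1) := by
    refine monotoneOn_unitInterval_of_hasDerivWithinAt_nonneg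
      (f := fun t => g t - g 1 + M * (1 - t)) (fun t ht => ?_) (fun t ht => ?_)
    · have hlin := ((hasDerivAt_id t).const_mul (g 1)).hasDerivWithinAt (s := Icc (0 : ℝ) 1)
      have hquad := (((((hasDerivAt_id t).const_sub 1).pow 2).const_mul M).div_const
        2).hasDerivWithinAt (s := Icc (0 : ℝ) 1)
      exact (((hG t ht).sub hlin).sub hquad).congr_deriv (by norm_num; ring)
    · have h := (abs_le.1 (hL t ht 1 h1)).1
      rw [abs_sub_comm, abs_of_nonneg (sub_nonneg.2 ht.2)] at h
      linarith
  have hmid := monotoneOn_unitInterval_of_hasDerivWithinAt_nonneg hG hg hpI hqI hpq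
  have hl := hleft h0 hpI hp
  have hr := hright hqI h1 hq
  norm_num at hl hr
  linarith

lemma hasDerivAt_posPart_sq (x : ℝ) :
    HasDerivAt (fun y : ℝ => max y 0 ^ 2) (2 * max x 0) x := by
  rcases lt_trichotomy x 0 with hx | rfl | hx
  · rw [max_eq_right hx.le, mul_zero]
    refine (hasDerivAt_const x (0 : ℝ)).congr_of_eventuallyEq ?_
    filter_upwards [gt_mem_nhds hx] with y hy
    simp [max_eq_right hy.le]
  · rw [hasDerivAt_iff_isLittleO_nhds_zero]
    have h : (fun y : ℝ => y ^ 2) =o[nhds 0] fun y => y := by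
      simpa using Asymptotics.isLittleO_pow_pow (𝕜 := ℝ) (m := 1) (n := 2) (by norm_num)
    refine Asymptotics.IsBigO.trans_isLittleO (.of_norm_le fun y => ?_) h
    rcases le_total y 0 with hy | hy <;> simp [hy, sq_nonneg]
  · rw [max_eq_left hx.le]
    refine ((hasDerivAt_pow 2 x).congr_deriv (by norm_num)).congr_of_eventuallyEq ?_
    filter_upwards [lt_mem_nhds hx] with y hy
    simp [max_eq_left hy.le]

/-- Two unit-slope ramps with disjoint supports add up to a function with Lipschitz constant 1. -/
lemma abs_ramp_sum_sub_le {a b M : ℝ} (h : a + b ≤ M) (x y : ℝ) :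
    |max (a - x) 0 + max (b - (M - x)) 0 - (max (a - y) 0 + max (b - (M - y)) 0)| ≤ |x - y| := by
  rw [abs_le]
  rcases max_cases (a - x) 0 with h₁ | h₁ <;> rcases max_cases (b - (M - x)) 0 with h₂ | h₂ <;>
    rcases max_cases (a - y) 0 with h₃ | h₃ <;> rcases max_cases (b - (M - y)) 0 with h₄ | h₄ <;>
    rcases abs_cases (x - y) with h₅ | h₅ <;> constructor <;> linarith


/-- In the regime `0 < a + b` and `2c(a+b) ≤ a² + b²` (i.e. `c ≤ c₀`), the infimum of
admissible Lipschitz constants `M` for monotone Hermite interpolants equals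
`(a² + b²)/(2c)`, and it is attained. -/
theorem Mstar_eq_small_c
    (a b c : ℝ) (ha : 0 ≤ a) (hb : 0 ≤ b) (hab : 0 < a + b) (hc : 0 < c)
    (hreg : 2 * c * (a + b) ≤ a ^ 2 + b ^ 2) :
    IsLeast { M : ℝ | 0 ≤ M ∧ ∃ G g : ℝ → ℝ,
        (∀ t ∈ Set.Icc (0:ℝ) 1, HasDerivWithinAt G (g t) (Set.Icc (0:ℝ) 1) t) ∧
        G 0 = 0 ∧ G 1 = c ∧ g 0 = a ∧ g 1 = b ∧
        (∀ t ∈ Set.Icc (0:ℝ) 1, 0 ≤ g t) ∧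
        (∀ s ∈ Set.Icc (0:ℝ) 1, ∀ t ∈ Set.Icc (0:ℝ) 1, |g s - g t| ≤ M * |s - t|) }
      ((a ^ 2 + b ^ 2) / (2 * c)) := by
  have hsq : 0 < a ^ 2 + b ^ 2 := lt_of_lt_of_le (by positivity) hreg
  constructor
  · set M := (a ^ 2 + b ^ 2) / (2 * c) with hM
    have hMpos : 0 < M := by positivity
    have habM : a + b ≤ M := by
      rw [hM, le_div_iff₀ (by positivity)]
      linarith
    refine ⟨hMpos.le, fun t => (a ^ 2 - max (a - M * t) 0 ^ 2 +
      max (b - (M - M * t)) 0 ^ 2) / (2 * M),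
      fun t => max (a - M * t) 0 + max (b - (M - M * t)) 0, ?_, ?_, ?_, ?_, ?_, ?_, ?_⟩
    · intro t _
      have hlin : HasDerivAt (fun t => M * t) M t := by
        simpa using (hasDerivAt_id t).const_mul M
      have hl := (hasDerivAt_posPart_sq (a - M * t)).comp t (hlin.const_sub a)
      have hr := (hasDerivAt_posPart_sq (b - (M - M * t))).comp t
        ((hlin.const_sub M).const_sub b)
      refine (((hl.const_sub (a ^ 2)).add hr).div_const (2 * M)).hasDerivWithinAt.congr_deriv ?_
      field_simp
    · simp [max_eq_left ha, max_eq_right (show b - M ≤ 0 by linarith)]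
    · simp only [mul_one, sub_self, sub_zero, max_eq_left hb,
        max_eq_right (show a - M ≤ 0 by linarith)]
      rw [hM]
      field_simp
      ring
    · simp [max_eq_left ha, max_eq_right (show b - M ≤ 0 by linarith)]
    · simp [max_eq_left hb, max_eq_right (show a - M ≤ 0 by linarith)]
    · intro t _
      positivity
    · intro s _ t _
      refine (abs_ramp_sum_sub_le habM (M * s) (M * t)).trans_eq ?_
      rw [← mul_sub, abs_mul, abs_of_pos hMpos]
  · rintro M ⟨-, G, g, hG, hG0, hG1, rfl, rfl, hg, hL⟩
    set a := g 0
    set b := g 1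
    have habM : a + b ≤ M := by
      have h := increment_ge_of_lipschitz_deriv hG hg hL (p := a / (a + b)) (q := a / (a + b))
        (by positivity) le_rfl (div_le_one_of_le₀ (by linarith) hab.le)
      have hq : 1 - a / (a + b) = b / (a + b) := by field_simp; ring
      rw [hq, hG0, hG1, sub_zero] at h
      have hc' : c ≤ (a ^ 2 + b ^ 2) / (2 * (a + b)) := by
        rw [le_div_iff₀ (by positivity)]
        linarith
      have h' : 0 ≤ (a ^ 2 + b ^ 2) * (M - (a + b)) / (2 * (a + b) ^ 2) := by
        refine (sub_nonneg.2 (h.trans hc')).trans_eq ?_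
        field_simp
        ring
      rw [le_div_iff₀ (by positivity), zero_mul] at h'
      linarith [nonneg_of_mul_nonneg_right h' hsq]
    have hMpos : 0 < M := hab.trans_le habM
    have hpq : a / M ≤ 1 - b / M := by
      rw [le_sub_iff_add_le, ← add_div]
      exact div_le_one_of_le₀ habM hMpos.le
    have h := increment_ge_of_lipschitz_deriv hG hg hL (p := a / M) (q := 1 - b / M)
      (by positivity) hpq (sub_le_self _ (by positivity))
    rw [hG0, hG1, sub_zero, sub_sub_cancel] at h
    have h' : (a ^ 2 + b ^ 2) / (2 * M) ≤ c := by
      refine le_of_eq_of_le ?_ h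
      field_simp
      ring
    rw [div_le_iff₀ (by positivity)] at h' ⊢
    linarith
end

section
/- Let a, b ≥ 0 and c > 0 satisfy a² + b² ≤ 2c(a+b) (with the convention that this also covers a = b = 0). Then the infimum of the set { M ≥ 0 : there exists G : ℝ → ℝ differentiable on [0,1] with G(0) = 0, G(1) = c, G'(0) = a, G'(1) = b, G'(t) ≥ 0 for all t ∈ [0,1], and G' Lipschitz on [0,1] with constant M } equals |2c − a − b| + √((2c − a − b)² + (b − a)²); moreover this infimum is attained. -/
open Set

theorem hasDerivAt_mul_abs_self (x : ℝ) : HasDerivAt (fun y : ℝ => y * |y|) (2 * |x|) x := by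
  rcases eq_or_ne x 0 with rfl | hx
  · rw [hasDerivAt_iff_tendsto_slope_zero]
    have h : Filter.Tendsto (fun t : ℝ => |t|) (nhdsWithin 0 {0}ᶜ) (nhds (2 * |(0 : ℝ)|)) := by
      have h0 := (continuous_abs (G := ℝ)).tendsto 0
      simp only [abs_zero, mul_zero] at h0 ⊢
      exact h0.mono_left nhdsWithin_le_nhds
    refine h.congr' ?_
    filter_upwards [self_mem_nhdsWithin] with t ht
    have ht0 : t ≠ 0 := ht
    simp [ht0]
  · rcases lt_or_gt_of_ne hx with h | h
    · have h1 := (hasDerivAt_id x).mul (hasDerivAt_abs_neg h)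
      refine h1.congr_deriv ?_
      simp only [id, abs_of_neg h]
      ring
    · have h1 := (hasDerivAt_id x).mul (hasDerivAt_abs_pos h)
      refine h1.congr_deriv ?_
      simp only [id, abs_of_pos h]
      ring

/-- A primitive of the hat function `t ↦ A - K * |t - p|`. -/
noncomputable def hatPrimitive (A K p t : ℝ) : ℝ :=
  A * t - K / 2 * ((t - p) * |t - p| + p * |p|)

theorem hasDerivAt_hatPrimitive (A K p t : ℝ) :
    HasDerivAt (hatPrimitive A K p) (A - K * |t - p|) t := by
  have h1 : HasDerivAt (fun y : ℝ => (y - p) * |y - p|) (2 * |t - p|) t :=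
    (hasDerivAt_mul_abs_self (t - p)).comp_sub_const t p
  have h2 := ((hasDerivAt_id t).const_mul A).sub ((h1.add_const (p * |p|)).const_mul (K / 2))
  refine h2.congr_deriv ?_
  ring

theorem hatPrimitive_zero (A K p : ℝ) : hatPrimitive A K p 0 = 0 := by
  simp [hatPrimitive]

theorem hatPrimitive_one (A K : ℝ) {p : ℝ} (hp : p ∈ Icc (0 : ℝ) 1) :
    hatPrimitive A K p 1 = A - K / 2 * ((1 - p) ^ 2 + p ^ 2) := by
  rw [hatPrimitive, abs_of_nonneg hp.1, abs_of_nonneg (sub_nonneg.2 hp.2)]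
  ring

theorem exists_hat_apex {K d : ℝ} (h : |d| ≤ |K|) :
    ∃ p ∈ Icc (0 : ℝ) 1, 2 * K * p = K + d := by
  rcases eq_or_ne K 0 with rfl | hK
  · refine ⟨0, by simp, ?_⟩
    have : d = 0 := by simpa using h
    simp [this]
  · have hq : |d / K| ≤ 1 := by
      rw [abs_div]
      exact div_le_one_of_le₀ h (abs_nonneg K)
    obtain ⟨h1, h2⟩ := abs_le.1 hq
    refine ⟨(1 + d / K) / 2, ⟨by linarith, by linarith⟩, ?_⟩
    field_simp

theorem bounds_of_lipschitz_deriv {a b c M : ℝ} (hM : 0 ≤ M) {G g : ℝ → ℝ}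
    (hG : ∀ t ∈ Icc (0 : ℝ) 1, HasDerivWithinAt G (g t) (Icc (0 : ℝ) 1) t)
    (hG0 : G 0 = 0) (hG1 : G 1 = c) (hg0 : g 0 = a) (hg1 : g 1 = b)
    (hL : ∀ s ∈ Icc (0 : ℝ) 1, ∀ t ∈ Icc (0 : ℝ) 1, |g s - g t| ≤ M * |s - t|) :
    2 * c - a - b ≤ M ∧ (b - a) ^ 2 ≤ M ^ 2 - 2 * (2 * c - a - b) * M := by
  have h0 : (0 : ℝ) ∈ Icc (0 : ℝ) 1 := by simp
  have h1 : (1 : ℝ) ∈ Icc (0 : ℝ) 1 := by simp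
  have hd : |b - a| ≤ |M| := by
    have := hL 1 h1 0 h0
    rw [abs_of_nonneg hM]
    simpa [hg0, hg1] using this
  obtain ⟨p, hp, hpM⟩ := exists_hat_apex hd
  set A := (a + b + M) / 2 with hA
  have hderiv : ∀ t ∈ Icc (0 : ℝ) 1, HasDerivWithinAt (fun t => hatPrimitive A M p t - G t)
      (A - M * |t - p| - g t) (Icc (0 : ℝ) 1) t := fun t ht =>
    (hasDerivAt_hatPrimitive A M p t).hasDerivWithinAt.sub (hG t ht)
  have hle : ∀ t ∈ Icc (0 : ℝ) 1, 0 ≤ A - M * |t - p| - g t := by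
    intro t ht
    have e1 := le_of_abs_le (hL t ht 0 h0)
    have e2 := le_of_abs_le (hL t ht 1 h1)
    rw [sub_zero, abs_of_nonneg ht.1, hg0] at e1
    rw [abs_of_nonpos (sub_nonpos.2 ht.2), hg1] at e2
    rcases abs_cases (t - p) with ⟨e, -⟩ | ⟨e, -⟩ <;> rw [e] <;> linarith
  have hmono : MonotoneOn (fun t => hatPrimitive A M p t - G t) (Icc (0 : ℝ) 1) := by
    refine monotoneOn_of_hasDerivWithinAt_nonneg (convex_Icc 0 1)
      (fun t ht => (hderiv t ht).continuousWithinAt)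
      (fun t ht => (hderiv t (interior_subset ht)).mono interior_subset)
      (fun t ht => hle t (interior_subset ht))
  have key := hmono h0 h1 zero_le_one
  simp only [hatPrimitive_zero, hatPrimitive_one A M hp, hG0, hG1] at key
  have hs : 2 * c - a - b ≤ 2 * M * (p * (1 - p)) := by nlinarith
  have hdM : b - a = 2 * M * p - M := by linarith
  constructor
  · nlinarith [mul_nonneg hM (sq_nonneg (p - 1 / 2)), sq_nonneg p]
  · rw [hdM]
    nlinarith [mul_le_mul_of_nonneg_right hs hM]

theorem hat_nonneg {a b K p t : ℝ} (ha : 0 ≤ a) (hb : 0 ≤ b) (hpK : 2 * K * p = K + (b - a))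
    (hK : -K ≤ a + b) (ht : t ∈ Icc (0 : ℝ) 1) :
    0 ≤ (a + b + K) / 2 - K * |t - p| := by
  rcases le_total 0 K with h | h
  · have e1 := mul_nonneg h ht.1
    have e2 := mul_nonneg h (sub_nonneg.2 ht.2)
    rcases abs_cases (t - p) with ⟨e, -⟩ | ⟨e, -⟩ <;> rw [e] <;> linarith
  · nlinarith [mul_nonneg (neg_nonneg.2 h) (abs_nonneg (t - p))]

theorem exists_monotone_interpolant {a b c K : ℝ} (ha : 0 ≤ a) (hb : 0 ≤ b)
    (hK : -K ≤ a + b) (hd : |b - a| ≤ |K|)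
    (hroot : K ^ 2 = 2 * (2 * c - a - b) * K + (b - a) ^ 2)
    (hzero : K = 0 → 2 * c - a - b = 0) :
    ∃ G g : ℝ → ℝ,
      (∀ t ∈ Icc (0 : ℝ) 1, HasDerivWithinAt G (g t) (Icc (0 : ℝ) 1) t) ∧
      G 0 = 0 ∧ G 1 = c ∧ g 0 = a ∧ g 1 = b ∧
      (∀ t ∈ Icc (0 : ℝ) 1, 0 ≤ g t) ∧
      (∀ s ∈ Icc (0 : ℝ) 1, ∀ t ∈ Icc (0 : ℝ) 1, |g s - g t| ≤ |K| * |s - t|) := by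
  obtain ⟨p, hp, hpK⟩ := exists_hat_apex hd
  refine ⟨hatPrimitive ((a + b + K) / 2) K p, fun t => (a + b + K) / 2 - K * |t - p|,
    fun t _ => (hasDerivAt_hatPrimitive _ K p t).hasDerivWithinAt, hatPrimitive_zero _ _ _,
    ?_, ?_, ?_, fun t ht => hat_nonneg ha hb hpK hK ht, ?_⟩
  · rw [hatPrimitive_one _ _ hp]
    rcases eq_or_ne K 0 with h0 | h0
    · have := hzero h0
      subst h0
      linarith
    · have hdK : b - a = 2 * K * p - K := by linarith
      rw [hdK] at hroot
      have : K * (2 * c - a - b) = K * (2 * K * (p * (1 - p))) := by linarith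
      have := mul_left_cancel₀ h0 this
      linarith
  · simp only [zero_sub, abs_neg, abs_of_nonneg hp.1]
    linarith
  · simp only [abs_of_nonneg (sub_nonneg.2 hp.2)]
    linarith
  · intro s _ t _
    have e : (a + b + K) / 2 - K * |s - p| - ((a + b + K) / 2 - K * |t - p|)
        = K * (|t - p| - |s - p|) := by ring
    simp only [e, abs_mul]
    refine mul_le_mul_of_nonneg_left ?_ (abs_nonneg K)
    have := abs_abs_sub_abs_le_abs_sub (t - p) (s - p)
    rwa [sub_sub_sub_cancel_right, abs_sub_comm t s] at this


/-- In the regime `a² + b² ≤ 2c(a+b)` (i.e. `c ≥ c₀`), the infimum of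
admissible Lipschitz constants `M` for monotone Hermite interpolants equals
`|2c − a − b| + √((2c − a − b)² + (b − a)²)`, and it is attained. -/
theorem Mstar_eq_large_c
    (a b c : ℝ) (ha : 0 ≤ a) (hb : 0 ≤ b) (hc : 0 < c)
    (hreg : a ^ 2 + b ^ 2 ≤ 2 * c * (a + b)) :
    IsLeast { M : ℝ | 0 ≤ M ∧ ∃ G g : ℝ → ℝ,
        (∀ t ∈ Set.Icc (0:ℝ) 1, HasDerivWithinAt G (g t) (Set.Icc (0:ℝ) 1) t) ∧
        G 0 = 0 ∧ G 1 = c ∧ g 0 = a ∧ g 1 = b ∧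
        (∀ t ∈ Set.Icc (0:ℝ) 1, 0 ≤ g t) ∧
        (∀ s ∈ Set.Icc (0:ℝ) 1, ∀ t ∈ Set.Icc (0:ℝ) 1, |g s - g t| ≤ M * |s - t|) }
      (|2 * c - a - b| + Real.sqrt ((2 * c - a - b) ^ 2 + (b - a) ^ 2)) := by
  set s := 2 * c - a - b with hs
  set R := Real.sqrt (s ^ 2 + (b - a) ^ 2) with hR
  have hR0 : 0 ≤ R := Real.sqrt_nonneg _
  have hR2 : R ^ 2 = s ^ 2 + (b - a) ^ 2 := Real.sq_sqrt (by positivity)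
  have hdR : |b - a| ≤ R := Real.abs_le_sqrt (by nlinarith [sq_nonneg s])
  refine ⟨⟨by positivity, ?_⟩, ?_⟩
  · rcases le_or_gt 0 s with h | h
    · have hK : |s + R| = |s| + R := by
        rw [abs_of_nonneg (by positivity), abs_of_nonneg h]
      rw [← hK]
      refine exists_monotone_interpolant ha hb (by linarith) ?_ ?_ ?_
      · rw [hK]
        linarith [abs_nonneg s]
      · rw [← hs]
        nlinarith
      · intro h0
        linarith
    · have hK : |s - R| = |s| + R := by
        rw [abs_of_nonpos (by linarith), abs_of_neg h]
        ring
      have hRc : R ≤ 2 * c := by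
        refine Real.sqrt_le_iff.2 ⟨by linarith, ?_⟩
        rw [hs]
        nlinarith
      rw [← hK]
      refine exists_monotone_interpolant ha hb (by linarith) ?_ ?_ ?_
      · rw [hK]
        linarith [abs_nonneg s]
      · rw [← hs]
        nlinarith
      · intro h0
        linarith
  · rintro M ⟨hM, G, g, hG, hG0, hG1, hg0, hg1, -, hL⟩
    obtain ⟨u1, u2⟩ := bounds_of_lipschitz_deriv hM hG hG0 hG1 hg0 hg1 hL
    obtain ⟨l1, l2⟩ := bounds_of_lipschitz_deriv (a := -a) (b := -b) (c := -c)
      (G := fun t => -G t) (g := fun t => -g t) hM (fun t ht => (hG t ht).fun_neg)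
      (by simp [hG0]) (by simp [hG1]) (by simp [hg0]) (by simp [hg1])
      (fun x hx y hy => by
        rw [neg_sub_neg, abs_sub_comm]
        exact hL x hx y hy)
    have hRM : R ≤ M - |s| := by
      refine Real.sqrt_le_iff.2 ?_
      rcases abs_cases s with ⟨e, -⟩ | ⟨e, -⟩ <;> rw [e]
      · exact ⟨by linarith, by nlinarith⟩
      · exact ⟨by linarith, by nlinarith⟩
    linarith
end
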